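/- Let (X_n)_{n∈ℕ} be a sequence of real Banach spaces, let X = ∏_{n∈ℕ} X_n carry the product topology, and let A be a continuous linear operator on X. Then A generates a strongly continuous semigroup on X if and only if for every n ∈ ℕ there exists m ∈ ℕ such that for all k ∈ ℕ and all x ∈ X: if x_j = 0 for all j ≤ m then (A^k x)_j = 0 for all j ≤ n. Moreover, in this case the semigroup generated by A is uniformly continuous. -/

import Mathlib

open Filter Topology Set
open scoped Pointwise

theorem aux_hasSum_exp {Y F : Type*} [NormedAddCommGroup Y] [NormedSpace ℝ Y] [CompleteSpace Y]
    [NormedAddCommGroup F] [NormedSpace ℝ F] (C : Y →L[ℝ] Y) (Φ : Y →L[ℝ] F) (y : Y) (t : ℝ) :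
    HasSum (fun k : ℕ => (((k.factorial : ℝ)⁻¹) * t ^ k) • Φ ((C ^ k) y))
      (Φ (NormedSpace.exp (t • C) y)) := by
  have h := NormedSpace.exp_series_hasSum_exp' (𝕂 := ℝ) (t • C)
  have h2 := h.mapL (Φ.comp (ContinuousLinearMap.apply ℝ Y y))
  refine (h2.congr_fun ?_)
  intro k
  simp [smul_pow, smul_smul]

theorem aux_exp_add {Y : Type*} [NormedAddCommGroup Y] [NormedSpace ℝ Y] [CompleteSpace Y]
    (C : Y →L[ℝ] Y) (s t : ℝ) :
    NormedSpace.exp ((s + t) • C) = NormedSpace.exp (s • C) * NormedSpace.exp (t • C) := by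
  letI : NormedAlgebra ℚ (Y →L[ℝ] Y) := NormedAlgebra.restrictScalars ℚ ℝ _
  rw [add_smul, NormedSpace.exp_add_of_commute]
  exact ((Commute.refl C).smul_left s).smul_right t

section aux
variable {X : ℕ → Type*} [∀ n, NormedAddCommGroup (X n)] [∀ n, NormedSpace ℝ (X n)]

/-- Restriction to the first `m + 1` coordinates. -/
noncomputable def auxRes (X : ℕ → Type*) [∀ n, NormedAddCommGroup (X n)]
    [∀ n, NormedSpace ℝ (X n)] (m : ℕ) : (∀ n, X n) →L[ℝ] (∀ j : Fin (m + 1), X j) :=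
  ContinuousLinearMap.pi fun j => ContinuousLinearMap.proj (j : ℕ)

/-- Extension by zero. -/
noncomputable def auxExt (X : ℕ → Type*) [∀ n, NormedAddCommGroup (X n)]
    [∀ n, NormedSpace ℝ (X n)] (m : ℕ) : (∀ j : Fin (m + 1), X j) →L[ℝ] (∀ n, X n) :=
  ContinuousLinearMap.pi fun n =>
    if h : n < m + 1 then
      ContinuousLinearMap.proj (R := ℝ) (φ := fun j : Fin (m + 1) => X j) ⟨n, h⟩
    else 0

theorem aux_ext_res (m : ℕ) (x : ∀ n, X n) (j : ℕ) (hj : j ≤ m) :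
    auxExt X m (auxRes X m x) j = x j := by
  have : j < m + 1 := by omega
  simp only [auxExt, ContinuousLinearMap.coe_pi']
  rw [dif_pos this]
  rfl

/-- The compression of `A`. -/
noncomputable def auxHat (A : (∀ n, X n) →L[ℝ] (∀ n, X n)) (m : ℕ) :
    (∀ j : Fin (m + 1), X j) →L[ℝ] (∀ j : Fin (m + 1), X j) :=
  (auxRes X m).comp (A.comp (auxExt X m))

theorem aux_key (A : (∀ n, X n) →L[ℝ] (∀ n, X n)) (n m : ℕ)
    (hm : ∀ k : ℕ, ∀ x : ∀ n, X n, (∀ j ≤ m, x j = 0) → (A ^ k) x n = 0) (k : ℕ) :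
    ∀ (l : ℕ) (x : ∀ n, X n),
    (A ^ l) (auxExt X m ((auxHat A m ^ k) (auxRes X m x))) n = (A ^ (l + k)) x n := by
  have h0 : ∀ (l : ℕ) (x : ∀ n, X n),
      (A ^ l) (auxExt X m (auxRes X m x)) n = (A ^ l) x n := by
    intro l x
    have := hm l (auxExt X m (auxRes X m x) - x) (by
      intro j hj; simp [aux_ext_res m x j hj])
    rw [map_sub] at this
    exact sub_eq_zero.mp this
  induction k with
  | zero => intro l x; simpa using h0 l x
  | succ k ih =>
    intro l x
    rw [pow_succ', mul_apply_eq_comp]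
    change (A ^ l) (auxExt X m (auxRes X m (A (auxExt X m _)))) n = _
    rw [h0, ← mul_apply_eq_comp, ← pow_succ, ih (l + 1) x]
    rw [show l + 1 + k = l + (k + 1) by omega]

theorem aux_equi [∀ n, CompleteSpace (X n)] (T : ℝ → (∀ n, X n) →L[ℝ] (∀ n, X n))
    (hc : ∀ x : ∀ n, X n, ContinuousOn (fun t : ℝ => T t x) (Set.Ici 0)) (n : ℕ) :
    ∃ V ∈ 𝓝 (0 : ∀ n, X n), ∀ h ∈ Icc (0 : ℝ) 1, ∀ x ∈ V, ‖T h x n‖ < 1 := by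
  let 𝓕 : Icc (0 : ℝ) 1 → (∀ n, X n) →L[ℝ] X n := fun h =>
    (ContinuousLinearMap.proj n).comp (T h)
  have H : UniformEquicontinuous ((↑) ∘ 𝓕 : Icc (0 : ℝ) 1 → (∀ n, X n) → X n) := by
    refine (norm_withSeminorms ℝ (X n)).banach_steinhaus (𝓕 := 𝓕) ?_
    intro _ x
    have hcont : ContinuousOn (fun t : ℝ => ‖T t x n‖) (Icc 0 1) :=
      (((continuous_apply n).comp_continuousOn (hc x)).norm).mono Icc_subset_Ici_self
    have hb := isCompact_Icc.bddAbove_image hcont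
    refine hb.mono ?_
    rintro _ ⟨h, rfl⟩
    exact ⟨h, h.2, rfl⟩
  have h0 := H.equicontinuous 0 _ (Metric.dist_mem_uniformity one_pos)
  refine ⟨_, h0, ?_⟩
  intro h hh x hx
  have := hx ⟨h, hh⟩
  simpa [𝓕] using this

theorem aux_rightderiv (A : (∀ n, X n) →L[ℝ] (∀ n, X n))
    (T : ℝ → (∀ n, X n) →L[ℝ] (∀ n, X n))
    (hs : ∀ s t : ℝ, 0 ≤ s → 0 ≤ t → T (s + t) = (T s).comp (T t))
    (hg : ∀ x : ∀ n, X n,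
        Tendsto (fun h : ℝ => h⁻¹ • (T h x - x)) (𝓝[>] 0) (𝓝 (A x)))
    (x : ∀ n, X n) (n : ℕ) (t : ℝ) (ht : 0 ≤ t) :
    HasDerivWithinAt (fun s => T s x n) (T t (A x) n) (Ici t) t := by
  rw [← hasDerivWithinAt_Ioi_iff_Ici, hasDerivWithinAt_iff_tendsto_slope' (by simp)]
  have h1 : Tendsto (fun h : ℝ => T t (h⁻¹ • (T h x - x)) n) (𝓝[>] 0) (𝓝 (T t (A x) n)) :=
    (((continuous_apply n).comp (T t).continuous).tendsto _).comp (hg x)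
  have h2 : Tendsto (fun s : ℝ => s - t) (𝓝[>] t) (𝓝[>] 0) := by
    refine tendsto_nhdsWithin_iff.mpr ⟨?_, ?_⟩
    · have : Tendsto (fun s : ℝ => s - t) (𝓝 t) (𝓝 (t - t)) :=
        (continuous_id.sub continuous_const).tendsto t
      rw [sub_self] at this
      exact this.mono_left nhdsWithin_le_nhds
    · filter_upwards [self_mem_nhdsWithin] with s hst
      exact sub_pos.mpr (mem_Ioi.mp hst)
  refine (h1.comp h2).congr' ?_
  filter_upwards [self_mem_nhdsWithin] with s hst
  have hst' : 0 ≤ s - t := (sub_pos.mpr (mem_Ioi.mp hst)).le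
  have := hs t (s - t) ht hst'
  rw [add_sub_cancel] at this
  simp [slope_def_module, this]

theorem aux_forward [∀ n, CompleteSpace (X n)] (A : (∀ n, X n) →L[ℝ] (∀ n, X n))
    (T : ℝ → (∀ n, X n) →L[ℝ] (∀ n, X n))
    (h0 : T 0 = ContinuousLinearMap.id ℝ (∀ n, X n))
    (hs : ∀ s t : ℝ, 0 ≤ s → 0 ≤ t → T (s + t) = (T s).comp (T t))
    (hc : ∀ x : ∀ n, X n, ContinuousOn (fun t : ℝ => T t x) (Set.Ici 0))
    (hg : ∀ x : ∀ n, X n,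
        Tendsto (fun h : ℝ => h⁻¹ • (T h x - x)) (𝓝[>] 0) (𝓝 (A x))) (n : ℕ) :
    ∃ m : ℕ, ∀ k : ℕ, ∀ x : ∀ n, X n,
      (∀ j ≤ m, x j = 0) → ∀ j ≤ n, (A ^ k) x j = 0 := by
  -- single coordinate version
  have single : ∀ n, ∃ m : ℕ, ∀ k : ℕ, ∀ x : ∀ n, X n,
      (∀ j ≤ m, x j = 0) → (A ^ k) x n = 0 := by
    intro n
    obtain ⟨V, hV, hT⟩ := aux_equi T hc n
    rw [nhds_pi, Filter.mem_pi] at hV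
    obtain ⟨I, hI, t, ht, hIt⟩ := hV
    obtain ⟨m, hm⟩ := hI.bddAbove
    refine ⟨m, ?_⟩
    intro k x hx
    have hz : ∀ h ∈ Icc (0 : ℝ) 1, T h x n = 0 := by
      intro h hh
      by_contra hne
      have hpos : 0 < ‖T h x n‖ := norm_pos_iff.mpr hne
      have := hT h hh ((‖T h x n‖)⁻¹ • x) (hIt (by
        intro j hj
        have : x j = 0 := hx j (hm hj)
        simpa [this] using mem_of_mem_nhds (ht j)))
      rw [map_smul, Pi.smul_apply, norm_smul, norm_inv, norm_norm,
        inv_mul_cancel₀ hpos.ne'] at this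
      exact lt_irrefl _ this
    have hk : ∀ k : ℕ, ∀ h ∈ Ico (0 : ℝ) 1, T h ((A ^ k) x) n = 0 := by
      intro k
      induction k with
      | zero => intro h hh; simpa using hz h ⟨hh.1, hh.2.le⟩
      | succ k ih =>
        intro h hh
        have hd := aux_rightderiv A T hs hg ((A ^ k) x) n h hh.1
        have hd0 : HasDerivWithinAt (fun s => T s ((A ^ k) x) n) 0 (Ici h) h := by
          refine (hasDerivWithinAt_const h (Ici h) (0 : X n)).congr_of_eventuallyEq ?_
            (ih h hh)
          filter_upwards [Ico_mem_nhdsGE hh.2] with s hs'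
          exact ih s ⟨hh.1.trans hs'.1, hs'.2⟩
        rw [pow_succ', mul_apply_eq_comp]
        exact (uniqueDiffWithinAt_Ici h).eq_deriv _ hd hd0
    have := hk k 0 (by simp)
    simpa [h0] using this
  choose m hm using single
  refine ⟨(Finset.range (n + 1)).sup m, ?_⟩
  intro k x hx j hj
  refine hm j k x fun i hi => hx i (hi.trans ?_)
  exact Finset.le_sup (f := m) (Finset.mem_range.mpr (by omega))

theorem aux_unif [∀ n, CompleteSpace (X n)] (A : (∀ n, X n) →L[ℝ] (∀ n, X n))
    (T : ℝ → (∀ n, X n) →L[ℝ] (∀ n, X n))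
    (h0 : T 0 = ContinuousLinearMap.id ℝ (∀ n, X n))
    (hs : ∀ s t : ℝ, 0 ≤ s → 0 ≤ t → T (s + t) = (T s).comp (T t))
    (hc : ∀ x : ∀ n, X n, ContinuousOn (fun t : ℝ => T t x) (Set.Ici 0))
    (hg : ∀ x : ∀ n, X n,
        Tendsto (fun h : ℝ => h⁻¹ • (T h x - x)) (𝓝[>] 0) (𝓝 (A x)))
    (B : Set (∀ n, X n)) (hB : Bornology.IsVonNBounded ℝ B) :
    TendstoUniformlyOn (fun (h : ℝ) (x : ∀ n, X n) => T h x)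
          (fun x => x) (𝓝[>] 0) B := by
  rw [tendstoUniformlyOn_iff_tendsto, Pi.uniformity, tendsto_iInf]
  intro n
  rw [tendsto_comap_iff]
  change Tendsto (fun q : ℝ × (∀ n, X n) => (q.2 n, T q.1 q.2 n)) _ _
  rw [← tendstoUniformlyOn_iff_tendsto (F := fun (h : ℝ) (x : ∀ n, X n) => T h x n)
    (f := fun x => x n)]
  obtain ⟨V, hV, hT⟩ := aux_equi T hc n
  have hAB : Absorbs ℝ V (A '' B) := (hB.image A) hV
  obtain ⟨c, hcAB, hcne⟩ : ∃ c : ℝ, A '' B ⊆ c • V ∧ c ≠ 0 :=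
    (hAB.eventually.and (Bornology.eventually_ne_cobounded 0)).exists
  have hbound : ∀ x ∈ B, ∀ h ∈ Icc (0 : ℝ) 1, ‖T h (A x) n‖ ≤ |c| := by
    intro x hx h hh
    obtain ⟨v, hv, hvx⟩ := hcAB ⟨x, hx, rfl⟩
    have hvx' : c • v = A x := hvx
    rw [← hvx', map_smul, Pi.smul_apply, norm_smul, Real.norm_eq_abs]
    exact mul_le_of_le_one_right (abs_nonneg c) (hT h hh v hv).le
  have hlip : ∀ x ∈ B, ∀ h ∈ Icc (0 : ℝ) 1, ‖T h x n - x n‖ ≤ |c| * h := by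
    intro x hx h hh
    have := norm_image_sub_le_of_norm_deriv_right_le_segment
      (f := fun s => T s x n) (f' := fun s => T s (A x) n) (a := 0) (b := 1) (C := |c|)
      (((continuous_apply n).comp_continuousOn (hc x)).mono Icc_subset_Ici_self)
      (fun s hs' => aux_rightderiv A T hs hg x n s hs'.1)
      (fun s hs' => hbound x hx s ⟨hs'.1, hs'.2.le⟩) h hh
    simpa [h0] using this
  rw [Metric.tendstoUniformlyOn_iff]
  intro ε hε
  have hlim : Tendsto (fun h : ℝ => |c| * h) (𝓝[>] 0) (𝓝 0) := by
    have : Tendsto (fun h : ℝ => |c| * h) (𝓝 0) (𝓝 (|c| * 0)) :=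
      (continuous_const.mul continuous_id).tendsto 0
    rw [mul_zero] at this
    exact this.mono_left nhdsWithin_le_nhds
  filter_upwards [hlim.eventually (gt_mem_nhds hε), Ioc_mem_nhdsGT (zero_lt_one' ℝ)]
    with h hh1 hh2 x hx
  rw [dist_comm, dist_eq_norm]
  exact (hlip x hx h ⟨hh2.1.le, hh2.2⟩).trans_lt hh1

theorem aux_backward [∀ n, CompleteSpace (X n)] (A : (∀ n, X n) →L[ℝ] (∀ n, X n))
    (hA : ∀ n : ℕ, ∃ m : ℕ, ∀ k : ℕ, ∀ x : ∀ n, X n,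
      (∀ j ≤ m, x j = 0) → ∀ j ≤ n, (A ^ k) x j = 0) :
    ∃ T : ℝ → (∀ n, X n) →L[ℝ] (∀ n, X n),
      T 0 = ContinuousLinearMap.id ℝ (∀ n, X n) ∧
      (∀ s t : ℝ, 0 ≤ s → 0 ≤ t → T (s + t) = (T s).comp (T t)) ∧
      (∀ x : ∀ n, X n, ContinuousOn (fun t : ℝ => T t x) (Set.Ici 0)) ∧
      ∀ x : ∀ n, X n,
        Tendsto (fun h : ℝ => h⁻¹ • (T h x - x)) (𝓝[>] 0) (𝓝 (A x)) := by
  choose m hm using hA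
  have key := fun n => aux_key A n (m n) (fun k x hx => hm n k x hx n le_rfl)
  let Φ : ∀ n, (∀ j : Fin (m n + 1), X j) →L[ℝ] X n := fun n =>
    (ContinuousLinearMap.proj n).comp (auxExt X (m n))
  let C := fun n => auxHat A (m n)
  have key0 : ∀ n k x, Φ n ((C n ^ k) (auxRes X (m n) x)) = (A ^ k) x n := by
    intro n k x
    have := key n k 0 x
    rw [zero_add] at this
    exact this
  let T : ℝ → (∀ n, X n) →L[ℝ] (∀ n, X n) := fun t => ContinuousLinearMap.pi fun n =>
    (Φ n).comp ((NormedSpace.exp (t • C n)).comp (auxRes X (m n)))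
  have hTn : ∀ t x n, T t x n = Φ n (NormedSpace.exp (t • C n) (auxRes X (m n) x)) :=
    fun t x n => rfl
  have hsumn : ∀ t x n, HasSum (fun k : ℕ => (((k.factorial : ℝ)⁻¹) * t ^ k) • (A ^ k) x n)
      (T t x n) := by
    intro t x n
    have := aux_hasSum_exp (C n) (Φ n) (auxRes X (m n) x) t
    simp only [key0] at this
    exact this
  have hsum : ∀ t x, HasSum (fun k : ℕ => (((k.factorial : ℝ)⁻¹) * t ^ k) • (A ^ k) x)
      (T t x) := fun t x => Pi.hasSum.mpr fun n => hsumn t x n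
  have hcomm : ∀ t x k, (A ^ k) (T t x) = T t ((A ^ k) x) := by
    intro t x k
    refine HasSum.unique ((hsum t x).mapL (A ^ k)) ?_
    refine (hsum t ((A ^ k) x)).congr_fun ?_
    intro l
    rw [map_smul, ← mul_apply_eq_comp, ← mul_apply_eq_comp,
      ← pow_add, ← pow_add, add_comm]
  have hswap : ∀ t x k n, T t ((A ^ k) x) n =
      Φ n (NormedSpace.exp (t • C n) ((C n ^ k) (auxRes X (m n) x))) := by
    intro t x k n
    refine HasSum.unique (hsumn t ((A ^ k) x) n) ?_
    refine (aux_hasSum_exp (C n) (Φ n) ((C n ^ k) (auxRes X (m n) x)) t).congr_fun ?_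
    intro l
    rw [← mul_apply_eq_comp, ← mul_apply_eq_comp,
      ← pow_add, ← pow_add, key0]
  have hderiv : ∀ t x n, HasDerivAt (fun s => T s x n)
      (Φ n ((NormedSpace.exp (t • C n) * C n) (auxRes X (m n) x))) t := by
    intro t x n
    have h := hasDerivAt_exp_smul_const (𝕂 := ℝ) (C n) t
    exact ((Φ n).comp (ContinuousLinearMap.apply ℝ _ (auxRes X (m n) x))).hasFDerivAt.comp_hasDerivAt
      t h
  have hT0 : T 0 = ContinuousLinearMap.id ℝ (∀ n, X n) := by
    ext x n
    rw [hTn, zero_smul, NormedSpace.exp_zero]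
    simpa using key0 n 0 x
  refine ⟨T, hT0, ?_, ?_, ?_⟩
  · intro s t _ _
    ext x n
    rw [ContinuousLinearMap.comp_apply]
    have h1 := hsumn s (T t x) n
    simp only [hcomm, hswap] at h1
    have h2 := aux_hasSum_exp (C n) ((Φ n).comp (NormedSpace.exp (t • C n)))
      (auxRes X (m n) x) s
    have h3 := h1.unique h2
    rw [h3, hTn, add_comm s t, aux_exp_add]
    rfl
  · intro x
    refine Continuous.continuousOn (continuous_pi fun n => ?_)
    exact continuous_iff_continuousAt.mpr fun t => (hderiv t x n).continuousAt
  · intro x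
    rw [tendsto_pi_nhds]
    intro n
    have h := (hderiv 0 x n).hasDerivWithinAt (s := Ioi 0)
    rw [hasDerivWithinAt_iff_tendsto_slope' (by simp)] at h
    have hv : Φ n ((NormedSpace.exp ((0 : ℝ) • C n) * C n) (auxRes X (m n) x)) = A x n := by
      rw [zero_smul, NormedSpace.exp_zero, one_mul]
      simpa using key0 n 1 x
    rw [hv] at h
    refine h.congr fun s => ?_
    simp [slope_def_module, hT0]

end aux

/-- A continuous linear operator `A` on a countable product
`X = ∏ₙ Xₙ` of real Banach spaces generates a strongly continuous semigroup
iff for every `n` there is `m` such that for all `k` and `x`: `x_j = 0` for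
all `j ≤ m` implies `(A^k x)_j = 0` for all `j ≤ n`; moreover, the generated
semigroup is then uniformly continuous. -/
theorem stmt16 {X : ℕ → Type*} [∀ n, NormedAddCommGroup (X n)]
    [∀ n, NormedSpace ℝ (X n)] [∀ n, CompleteSpace (X n)]
    (A : (∀ n, X n) →L[ℝ] (∀ n, X n)) :
    ((∃ T : ℝ → (∀ n, X n) →L[ℝ] (∀ n, X n),
      T 0 = ContinuousLinearMap.id ℝ (∀ n, X n) ∧
      (∀ s t : ℝ, 0 ≤ s → 0 ≤ t → T (s + t) = (T s).comp (T t)) ∧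
      (∀ x : ∀ n, X n, ContinuousOn (fun t : ℝ => T t x) (Set.Ici 0)) ∧
      ∀ x : ∀ n, X n,
        Tendsto (fun h : ℝ => h⁻¹ • (T h x - x)) (𝓝[>] 0) (𝓝 (A x))) ↔
    (∀ n : ℕ, ∃ m : ℕ, ∀ k : ℕ, ∀ x : ∀ n, X n,
      (∀ j ≤ m, x j = 0) → ∀ j ≤ n, (A ^ k) x j = 0)) ∧
    ∀ T : ℝ → (∀ n, X n) →L[ℝ] (∀ n, X n),
      T 0 = ContinuousLinearMap.id ℝ (∀ n, X n) →
      (∀ s t : ℝ, 0 ≤ s → 0 ≤ t → T (s + t) = (T s).comp (T t)) →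
      (∀ x : ∀ n, X n, ContinuousOn (fun t : ℝ => T t x) (Set.Ici 0)) →
      (∀ x : ∀ n, X n,
        Tendsto (fun h : ℝ => h⁻¹ • (T h x - x)) (𝓝[>] 0) (𝓝 (A x))) →
      ∀ B : Set (∀ n, X n), Bornology.IsVonNBounded ℝ B →
        TendstoUniformlyOn (fun (h : ℝ) (x : ∀ n, X n) => T h x)
          (fun x => x) (𝓝[>] 0) B := by
  refine ⟨⟨?_, aux_backward A⟩, ?_⟩
  · rintro ⟨T, h0, hs, hc, hg⟩ n
    exact aux_forward A T h0 hs hc hg n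
  · intro T h0 hs hc hg B hB
    exact aux_unif A T h0 hs hc hg B hB
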